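/- Let $C\subseteq\mathbb{R}^d$ be a pointed full-dimensional rational cone that fails (UHC). Suppose $C$ is minimal first with respect to dimension and second with respect to the cardinality of its Hilbert basis: every pointed full-dimensional rational cone of dimension $<d$ satisfies (UHC), and every pointed full-dimensional rational cone in $\mathbb{R}^d$ whose Hilbert basis has fewer elements than $\operatorname{Hilb}(C)$ satisfies (UHC). Then $C$ is tight: every element of $\operatorname{Hilb}(C)$ is destructive. -/

import Mathlib

/-- The real vector corresponding to an integer vector. -/
def toR {d : ℕ} (x : Fin d → ℤ) : Fin d → ℝ := fun i => (x i : ℝ)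

/-- The cone generated by a finite family of integer vectors. -/
def coneFin {d n : ℕ} (v : Fin n → (Fin d → ℤ)) : Set (Fin d → ℝ) :=
  { y | ∃ a : Fin n → ℝ, (∀ i, 0 ≤ a i) ∧ y = ∑ i, a i • toR (v i) }

/-- The cone generated by a set of integer vectors (nonnegative real combinations
of finitely many of its elements). -/
def coneSet {d : ℕ} (B : Set (Fin d → ℤ)) : Set (Fin d → ℝ) :=
  { y | ∃ (n : ℕ) (v : Fin n → (Fin d → ℤ)) (a : Fin n → ℝ),
      (∀ i, v i ∈ B) ∧ (∀ i, 0 ≤ a i) ∧ y = ∑ i, a i • toR (v i) }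

/-- A finitely generated rational cone. -/
def IsRatCone {d : ℕ} (C : Set (Fin d → ℝ)) : Prop :=
  ∃ B : Finset (Fin d → ℤ), C = coneSet (B : Set (Fin d → ℤ))

/-- A pointed cone: `x, -x ∈ C` implies `x = 0`. -/
def PointedSet {d : ℕ} (C : Set (Fin d → ℝ)) : Prop :=
  ∀ x ∈ C, -x ∈ C → x = 0

/-- A full-dimensional subset of `ℝ^d`. -/
def FullDim {d : ℕ} (C : Set (Fin d → ℝ)) : Prop :=
  Submodule.span ℝ C = ⊤

/-- The Hilbert basis of the monoid `C ∩ ℤ^d`: the nonzero lattice points of `C`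
admitting no decomposition into two nonzero lattice points of `C`. -/
def hilbC {d : ℕ} (C : Set (Fin d → ℝ)) : Set (Fin d → ℤ) :=
  { z | toR z ∈ C ∧ z ≠ 0 ∧
    ¬∃ u v : Fin d → ℤ, toR u ∈ C ∧ toR v ∈ C ∧ u ≠ 0 ∧ v ≠ 0 ∧ z = u + v }

/-- `C` satisfies (UHC): `C` is the union of its unimodular Hilbert subcones,
i.e. every point of `C` lies in a cone generated by `d` elements of `Hilb(C)`
forming a `ℤ`-basis of `ℤ^d`. -/
def UHC {d : ℕ} (C : Set (Fin d → ℝ)) : Prop :=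
  ∀ p ∈ C, ∃ y : Fin d → (Fin d → ℤ), (∀ k, y k ∈ hilbC C) ∧
    LinearIndependent ℤ y ∧ AddSubgroup.closure (Set.range y) = ⊤ ∧
    p ∈ coneFin y

/-- `x ∈ Hilb(C)` is destructive if `H' = Hilb(C) \ {x}` is not the Hilbert
basis of the cone `ℝ₊H'`; `C` is tight if every Hilbert basis element is
destructive. -/
def Tight {d : ℕ} (C : Set (Fin d → ℝ)) : Prop :=
  ∀ x ∈ hilbC C, hilbC (coneSet (hilbC C \ {x})) ≠ hilbC C \ {x}

lemma toR_add {d : ℕ} (x y : Fin d → ℤ) : toR (x + y) = toR x + toR y := by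
  ext i; simp [toR]

lemma toR_sub {d : ℕ} (x y : Fin d → ℤ) : toR (x - y) = toR x - toR y := by
  ext i; simp [toR]

@[simp] lemma toR_zero {d : ℕ} : toR (0 : Fin d → ℤ) = 0 := by
  ext i; simp [toR]

lemma toR_zsmul {d : ℕ} (k : ℤ) (x : Fin d → ℤ) : toR (k • x) = (k : ℝ) • toR x := by
  ext i; simp [toR]

lemma toR_injective {d : ℕ} : Function.Injective (toR (d := d)) := fun x y h => by
  ext i
  have hi : (x i : ℝ) = y i := congrFun h i
  exact_mod_cast hi

lemma toR_eq_zero {d : ℕ} {x : Fin d → ℤ} : toR x = 0 ↔ x = 0 :=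
  ⟨fun h => toR_injective (h.trans toR_zero.symm), fun h => h ▸ toR_zero⟩

/-- The cone generated by `B` is the conic hull of the real vectors attached to `B`. -/
lemma coneSet_eq_hull {d : ℕ} (B : Set (Fin d → ℤ)) :
    coneSet B = (PointedCone.hull ℝ (toR '' B) : Set (Fin d → ℝ)) := by
  ext y
  constructor
  · rintro ⟨n, v, a, hv, ha, rfl⟩
    exact sum_mem fun i _ => PointedCone.smul_mem _ (ha i)
      (PointedCone.subset_hull ⟨_, hv i, rfl⟩)
  · intro hy
    refine Submodule.span_induction (p := fun y _ => y ∈ coneSet B) ?_ ?_ ?_ ?_ hy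
    · rintro _ ⟨b, hb, rfl⟩
      exact ⟨1, fun _ => b, fun _ => 1, fun _ => hb, fun _ => zero_le_one, by simp⟩
    · exact ⟨0, Fin.elim0, Fin.elim0, fun i => i.elim0, fun i => i.elim0, by simp⟩
    · rintro _ _ _ _ ⟨n, v, a, hv, ha, rfl⟩ ⟨m, w, b, hw, hb, rfl⟩
      refine ⟨n + m, Fin.append v w, Fin.append a b, fun i => ?_, fun i => ?_, ?_⟩
      · induction i using Fin.addCases <;> simp [hv, hw]
      · induction i using Fin.addCases <;> simp [ha, hb]
      · simp [Fin.sum_univ_add]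
    · rintro c _ _ ⟨n, v, a, hv, ha, rfl⟩
      refine ⟨n, v, fun i => (c : ℝ) * a i, hv, fun i => mul_nonneg c.2 (ha i), ?_⟩
      rw [Finset.smul_sum]
      exact Finset.sum_congr rfl fun i _ => by
        rw [mul_smul]; rfl

lemma coneSet_add {d : ℕ} {B : Set (Fin d → ℤ)} {y z : Fin d → ℝ}
    (hy : y ∈ coneSet B) (hz : z ∈ coneSet B) : y + z ∈ coneSet B := by
  rw [coneSet_eq_hull] at *
  exact add_mem hy hz

lemma coneSet_smul {d : ℕ} {B : Set (Fin d → ℤ)} {y : Fin d → ℝ} {c : ℝ} (hc : 0 ≤ c)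
    (hy : y ∈ coneSet B) : c • y ∈ coneSet B := by
  rw [coneSet_eq_hull] at *
  exact PointedCone.smul_mem _ hc hy

lemma toR_mem_coneSet {d : ℕ} {B : Set (Fin d → ℤ)} {b : Fin d → ℤ} (hb : b ∈ B) :
    toR b ∈ coneSet B := by
  rw [coneSet_eq_hull]
  exact PointedCone.subset_hull ⟨b, hb, rfl⟩

lemma zero_mem_coneSet {d : ℕ} (B : Set (Fin d → ℤ)) : 0 ∈ coneSet B := by
  rw [coneSet_eq_hull]
  exact zero_mem _

/-- A property stable under conic operations which holds on generators holds on the cone. -/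
lemma coneSet_induction {d : ℕ} {B : Set (Fin d → ℤ)} {p : (Fin d → ℝ) → Prop}
    (mem : ∀ b ∈ B, p (toR b)) (zero : p 0) (add : ∀ y z, p y → p z → p (y + z))
    (smul : ∀ (c : ℝ) y, 0 ≤ c → p y → p (c • y)) {y : Fin d → ℝ} (hy : y ∈ coneSet B) :
    p y := by
  rw [coneSet_eq_hull] at hy
  refine Submodule.span_induction (p := fun y _ => p y) ?_ zero (fun y z _ _ => add y z) ?_ hy
  · rintro _ ⟨b, hb, rfl⟩
    exact mem b hb
  · rintro ⟨c, hc⟩ y _ hy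
    exact smul c y hc hy

lemma coneSet_subset {d : ℕ} {A B : Set (Fin d → ℤ)} (h : ∀ a ∈ A, toR a ∈ coneSet B) :
    coneSet A ⊆ coneSet B := fun _ hy =>
  coneSet_induction h (zero_mem_coneSet B) (fun _ _ => coneSet_add)
    (fun _ _ hc => coneSet_smul hc) hy

lemma coneSet_finset {d : ℕ} (B : Finset (Fin d → ℤ)) {y : Fin d → ℝ}
    (hy : y ∈ coneSet (B : Set (Fin d → ℤ))) :
    ∃ a : (Fin d → ℤ) → ℝ, (∀ b, 0 ≤ a b) ∧ y = ∑ b ∈ B, a b • toR b := by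
  classical
  refine coneSet_induction (p := fun y => ∃ a : (Fin d → ℤ) → ℝ, (∀ b, 0 ≤ a b) ∧
    y = ∑ b ∈ B, a b • toR b) ?_ ?_ ?_ ?_ hy
  · intro b hb
    refine ⟨Pi.single b 1, fun c => ?_, ?_⟩
    · by_cases h : c = b
      · subst h; simp
      · simp [h]
    · rw [Finset.sum_eq_single b]
      · simp
      · intro c _ hc; simp [hc]
      · intro h; exact absurd hb h
  · exact ⟨0, fun _ => le_rfl, by simp⟩
  · rintro _ _ ⟨a, ha, rfl⟩ ⟨a', ha', rfl⟩
    exact ⟨a + a', fun b => add_nonneg (ha b) (ha' b), by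
      simp [add_smul, Finset.sum_add_distrib]⟩
  · rintro c _ hc ⟨a, ha, rfl⟩
    exact ⟨c • a, fun b => mul_nonneg hc (ha b), by simp [Finset.smul_sum, mul_smul]⟩

/-- Gordan's lemma. -/
lemma hilbC_finite {d : ℕ} (B : Finset (Fin d → ℤ)) :
    (hilbC (coneSet (B : Set (Fin d → ℤ)))).Finite := by
  classical
  refine ((B.finite_toSet).union (Set.finite_Icc (-∑ b ∈ B, |b|) (∑ b ∈ B, |b|))).subset ?_
  rintro z ⟨hz, hz0, hirr⟩
  obtain ⟨a, ha, hza⟩ := coneSet_finset B hz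
  by_cases hB : z ∈ B
  · exact Or.inl hB
  right
  have key : ∀ b ∈ B, b = 0 ∨ a b ≤ 1 := by
    intro b hb
    by_contra! hcon
    obtain ⟨hb0, hab⟩ := hcon
    refine hirr ⟨b, z - b, toR_mem_coneSet hb, ?_, hb0, ?_, by abel⟩
    · rw [toR_sub, hza, ← Finset.add_sum_erase _ _ hb,
        show ∀ s : Fin d → ℝ, a b • toR b + s - toR b = (a b - 1) • toR b + s by
          intro s; module]
      refine coneSet_add (coneSet_smul (by linarith) (toR_mem_coneSet hb)) ?_
      rw [coneSet_eq_hull]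
      exact sum_mem fun c hc => PointedCone.smul_mem _ (ha c)
        (PointedCone.subset_hull ⟨c, Finset.mem_of_mem_erase hc, rfl⟩)
    · intro h
      exact hB (sub_eq_zero.1 h ▸ hb)
  have hbound : ∀ i, |z i| ≤ (∑ b ∈ B, |b|) i := by
    intro i
    have h1 : (z i : ℝ) = ∑ b ∈ B, a b * (b i : ℝ) := by
      simpa [toR] using congrFun hza i
    have h2 : |(z i : ℝ)| ≤ ∑ b ∈ B, |(b i : ℝ)| := by
      rw [h1]
      refine (Finset.abs_sum_le_sum_abs _ _).trans (Finset.sum_le_sum fun b hb => ?_)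
      rw [abs_mul, abs_of_nonneg (ha b)]
      rcases key b hb with rfl | h
      · simp
      · exact mul_le_of_le_one_left (abs_nonneg _) h
    simp only [Pi.abs_apply, Finset.sum_apply]
    exact_mod_cast h2
  exact ⟨fun i => (abs_le.1 (hbound i)).1, fun i => (abs_le.1 (hbound i)).2⟩

/-- A pointed rational cone has a linear functional that is at least `1` at its nonzero
lattice points. -/
lemma exists_grading {d : ℕ} (B : Finset (Fin d → ℤ))
    (hp : PointedSet (coneSet (B : Set (Fin d → ℤ)))) :
    ∃ f : (Fin d → ℝ) →ₗ[ℝ] ℝ,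
      ∀ z : Fin d → ℤ, toR z ∈ coneSet (B : Set (Fin d → ℤ)) → z ≠ 0 → 1 ≤ f (toR z) := by
  set C := coneSet (B : Set (Fin d → ℤ))
  have hfin : ((toR '' (B : Set (Fin d → ℤ))) \ {0}).Finite :=
    (B.finite_toSet.image _).sdiff
  have hconv : Convex ℝ (C \ {0}) := by
    rintro u ⟨hu, hu0⟩ v ⟨hv, hv0⟩ s t hs ht hst
    refine ⟨coneSet_add (coneSet_smul hs hu) (coneSet_smul ht hv), fun h => ?_⟩
    have h0 : s • u + t • v = 0 := h
    have hsu : s • u = 0 := hp _ (coneSet_smul hs hu) (by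
      rw [neg_eq_of_add_eq_zero_right h0]; exact coneSet_smul ht hv)
    have htv : t • v = 0 := by simpa [hsu] using h0
    have hs0 : s = 0 := (smul_eq_zero.1 hsu).resolve_right hu0
    have ht0 : t = 0 := (smul_eq_zero.1 htv).resolve_right hv0
    simp [hs0, ht0] at hst
  have h0 : (0 : Fin d → ℝ) ∉ convexHull ℝ ((toR '' (B : Set (Fin d → ℤ))) \ {0}) := by
    intro h
    refine (convexHull_min ?_ hconv h).2 rfl
    rintro _ ⟨⟨b, hb, rfl⟩, h⟩
    exact ⟨toR_mem_coneSet hb, h⟩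
  obtain ⟨f, u, hu, hf⟩ := geometric_hahn_banach_point_closed (convex_convexHull ℝ _)
    (hfin.isCompact_convexHull ℝ).isClosed h0
  rw [map_zero] at hu
  obtain ⟨M, hM0, hM⟩ : ∃ M : ℝ, 0 < M ∧ ∀ b ∈ B, ‖toR b‖ ≤ M := by
    refine ⟨∑ b ∈ B, ‖toR b‖ + 1, by positivity, fun b hb => ?_⟩
    linarith [Finset.single_le_sum (f := fun b : Fin d → ℤ => ‖toR b‖)
      (fun b _ => norm_nonneg _) hb]
  have hbound : ∀ y ∈ C, ‖y‖ ≤ M / u * f y := fun y hy => by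
    refine coneSet_induction (p := fun y => ‖y‖ ≤ M / u * f y) ?_ ?_ ?_ ?_ hy
    · intro b hb
      by_cases hb0 : toR b = 0
      · simp [hb0]
      · have := hf _ (subset_convexHull ℝ _ ⟨⟨b, hb, rfl⟩, hb0⟩)
        calc ‖toR b‖ ≤ M := hM b hb
          _ = M / u * u := by field_simp
          _ ≤ M / u * f (toR b) := by gcongr
    · simp
    · intro y z hy hz
      calc ‖y + z‖ ≤ ‖y‖ + ‖z‖ := norm_add_le _ _
        _ ≤ M / u * f (y + z) := by rw [map_add, mul_add]; exact add_le_add hy hz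
    · intro c y hc hy
      rw [norm_smul, Real.norm_of_nonneg hc, map_smul, smul_eq_mul, mul_left_comm]
      exact mul_le_mul_of_nonneg_left hy hc
  refine ⟨(M / u) • f.toLinearMap, fun z hz hz0 => ?_⟩
  obtain ⟨i, hi⟩ := Function.ne_iff.1 hz0
  calc (1 : ℝ) ≤ ‖toR z i‖ := by
        have h1 : (1 : ℝ) ≤ |(z i : ℝ)| := by exact_mod_cast Int.one_le_abs hi
        rwa [Real.norm_eq_abs]
    _ ≤ ‖toR z‖ := norm_le_pi_norm _ i
    _ ≤ _ := hbound _ hz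

/-- The Hilbert basis of a pointed rational cone generates its monoid of lattice points. -/
lemma mem_closure_hilbC {d : ℕ} (B : Finset (Fin d → ℤ))
    (hp : PointedSet (coneSet (B : Set (Fin d → ℤ)))) {z : Fin d → ℤ}
    (hz : toR z ∈ coneSet (B : Set (Fin d → ℤ))) :
    z ∈ AddSubmonoid.closure (hilbC (coneSet (B : Set (Fin d → ℤ)))) := by
  obtain ⟨f, hf⟩ := exists_grading B hp
  obtain ⟨n, hn⟩ := exists_nat_ge (f (toR z))
  induction n generalizing z with
  | zero =>
    by_cases hz0 : z = 0
    · exact hz0 ▸ zero_mem _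
    · have := hf z hz hz0
      norm_num at hn
      linarith
  | succ n ih =>
    by_cases hz0 : z = 0
    · exact hz0 ▸ zero_mem _
    by_cases hirr : z ∈ hilbC (coneSet (B : Set (Fin d → ℤ)))
    · exact AddSubmonoid.subset_closure hirr
    obtain ⟨u, v, hu, hv, hu0, hv0, rfl⟩ : ∃ u v : Fin d → ℤ,
        toR u ∈ coneSet (B : Set (Fin d → ℤ)) ∧ toR v ∈ coneSet (B : Set (Fin d → ℤ)) ∧
        u ≠ 0 ∧ v ≠ 0 ∧ z = u + v := by
      by_contra h
      exact hirr ⟨hz, hz0, h⟩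
    have h1 := hf u hu hu0
    have h2 := hf v hv hv0
    rw [toR_add, map_add] at hn
    push_cast at hn
    exact add_mem (ih hu (by linarith)) (ih hv (by linarith))

lemma coneSet_hilbC {d : ℕ} (B : Finset (Fin d → ℤ))
    (hp : PointedSet (coneSet (B : Set (Fin d → ℤ)))) :
    coneSet (hilbC (coneSet (B : Set (Fin d → ℤ)))) = coneSet (B : Set (Fin d → ℤ)) := by
  refine (coneSet_subset fun h hh => hh.1).antisymm (coneSet_subset fun b hb => ?_)
  refine AddSubmonoid.closure_induction (fun h hh => toR_mem_coneSet hh) ?_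
    (fun y z _ _ hy hz => ?_) (mem_closure_hilbC B hp (toR_mem_coneSet hb))
  · rw [toR_zero]; exact zero_mem_coneSet _
  · rw [toR_add]; exact coneSet_add hy hz

/-- If the multiples of `x` form a saturated subgroup of `ℤ^(e+1)`, then `ℤ^(e+1)` splits as
`ℤ^e ⊕ ℤ x`. -/
lemma exists_splitting {e : ℕ} {x : Fin (e + 1) → ℤ} (hx : x ≠ 0)
    (hsat : ∀ (m : ℤ) (z : Fin (e + 1) → ℤ), m ≠ 0 → m • z ∈ Submodule.span ℤ {x} →
      z ∈ Submodule.span ℤ {x}) :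
    ∃ (P : (Fin (e + 1) → ℤ) →ₗ[ℤ] (Fin e → ℤ)) (S : (Fin e → ℤ) →ₗ[ℤ] (Fin (e + 1) → ℤ)),
      (∀ w, P (S w) = w) ∧ (∀ z, P z = 0 → ∃ k : ℤ, z = k • x) ∧ P x = 0 := by
  set N := Submodule.span ℤ {x}
  have htf : Module.IsTorsionFree ℤ ((Fin (e + 1) → ℤ) ⧸ N) := by
    rw [Module.isTorsionFree_iff_smul_eq_zero]
    intro m q hmq
    obtain ⟨z, rfl⟩ := N.mkQ_surjective q
    by_contra! h
    rw [← map_smul, Submodule.mkQ_apply, Submodule.Quotient.mk_eq_zero] at hmq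
    exact h.2 ((Submodule.Quotient.mk_eq_zero N).2 (hsat m z h.1 hmq))
  have hfree := Module.free_of_finite_type_torsion_free' (R := ℤ)
    (M := (Fin (e + 1) → ℤ) ⧸ N)
  have hrank : Module.finrank ℤ ((Fin (e + 1) → ℤ) ⧸ N) = e := by
    have h1 := Submodule.finrank_quotient_add_finrank (R := ℤ) N
    have h2 : Module.finrank ℤ N = 1 := by
      have := (LinearEquiv.toSpanNonzeroSingleton ℤ _ x hx).finrank_eq
      rw [← this]; simp
    rw [h2] at h1
    simpa using h1
  let b := Module.finBasisOfFinrankEq ℤ _ hrank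
  let P : (Fin (e + 1) → ℤ) →ₗ[ℤ] (Fin e → ℤ) := b.equivFun.toLinearMap ∘ₗ N.mkQ
  have hPker : ∀ z, P z = 0 ↔ z ∈ N := fun z => by
    simp [P]
  obtain ⟨S, hS⟩ := P.exists_rightInverse_of_surjective
    (LinearMap.range_eq_top.2 (b.equivFun.surjective.comp N.mkQ_surjective))
  refine ⟨P, S, fun w => LinearMap.congr_fun hS w, fun z hz => ?_,
    (hPker x).2 (Submodule.mem_span_singleton_self x)⟩
  obtain ⟨k, hk⟩ := Submodule.mem_span_singleton.1 ((hPker z).1 hz)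
  exact ⟨k, hk.symm⟩

/-- Real extension of a linear map between lattices. -/
noncomputable def realExt {n m : ℕ} (L : (Fin n → ℤ) →ₗ[ℤ] (Fin m → ℤ)) :
    (Fin n → ℝ) →ₗ[ℝ] (Fin m → ℝ) :=
  Matrix.toLin' ((LinearMap.toMatrix' L).map (Int.cast : ℤ → ℝ))

lemma realExt_toR {n m : ℕ} (L : (Fin n → ℤ) →ₗ[ℤ] (Fin m → ℤ)) (z : Fin n → ℤ) :
    realExt L (toR z) = toR (L z) := by
  ext i
  conv_rhs => rw [← LinearMap.toMatrix'_mulVec L z]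
  simp [realExt, toR, Matrix.mulVec, dotProduct]

lemma toR_single {d : ℕ} (i : Fin d) : toR (Pi.single i 1) = Pi.single i (1 : ℝ) := by
  ext j
  by_cases h : j = i
  · subst h; simp [toR]
  · simp [toR, h]

lemma span_range_toR (d : ℕ) : Submodule.span ℝ (Set.range (toR (d := d))) = ⊤ := by
  rw [eq_top_iff, ← (Pi.basisFun ℝ (Fin d)).span_eq]
  refine Submodule.span_mono ?_
  rintro _ ⟨i, rfl⟩
  exact ⟨Pi.single i 1, by simp [toR_single]⟩

lemma coneSet_image {n m : ℕ} (L : (Fin n → ℤ) →ₗ[ℤ] (Fin m → ℤ)) (B : Set (Fin n → ℤ)) :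
    realExt L '' coneSet B = coneSet (L '' B) := by
  apply Set.Subset.antisymm
  · rintro _ ⟨_, ⟨k, v, a, hv, ha, rfl⟩, rfl⟩
    exact ⟨k, fun i => L (v i), a, fun i => ⟨_, hv i, rfl⟩, ha, by simp [realExt_toR]⟩
  · rintro _ ⟨k, v, a, hv, ha, rfl⟩
    choose w hw hwv using hv
    exact ⟨_, ⟨k, w, a, hw, ha, rfl⟩, by simp [realExt_toR, hwv]⟩

lemma exists_eq_section_add {e : ℕ} {x : Fin (e + 1) → ℤ}
    {P : (Fin (e + 1) → ℤ) →ₗ[ℤ] (Fin e → ℤ)} {S : (Fin e → ℤ) →ₗ[ℤ] (Fin (e + 1) → ℤ)}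
    (hPS : ∀ w, P (S w) = w) (hker : ∀ z, P z = 0 → ∃ k : ℤ, z = k • x)
    (v : Fin (e + 1) → ℝ) : ∃ t : ℝ, v = realExt S (realExt P v) + t • toR x := by
  have hv : v ∈ Submodule.span ℝ (Set.range (toR (d := e + 1))) := by
    rw [span_range_toR]; trivial
  induction hv using Submodule.span_induction with
  | mem v hv =>
    obtain ⟨z, rfl⟩ := hv
    obtain ⟨k, hk⟩ := hker (z - S (P z)) (by rw [map_sub, hPS, sub_self])
    refine ⟨k, ?_⟩
    rw [realExt_toR, realExt_toR, ← toR_zsmul, ← toR_add, ← hk]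
    simp
  | zero => exact ⟨0, by simp⟩
  | add v w _ _ hv hw =>
    obtain ⟨s, hs⟩ := hv
    obtain ⟨t, ht⟩ := hw
    refine ⟨s + t, ?_⟩
    nth_rw 1 [hs, ht]
    simp only [map_add]
    module
  | smul c v _ hv =>
    obtain ⟨s, hs⟩ := hv
    refine ⟨c * s, ?_⟩
    nth_rw 1 [hs]
    simp only [map_smul]
    module

/-- A Hilbert basis element spans a saturated subgroup. -/
lemma saturated_of_mem_hilbC {d : ℕ} {B : Set (Fin d → ℤ)} {x : Fin d → ℤ}
    (hx : x ∈ hilbC (coneSet B)) (m : ℤ) (z : Fin d → ℤ) (hm : m ≠ 0)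
    (h : m • z ∈ Submodule.span ℤ {x}) : z ∈ Submodule.span ℤ {x} := by
  wlog hpos : 0 < m generalizing m
  · refine this (-m) (neg_ne_zero.2 hm) ?_ (by omega)
    rw [neg_smul]
    exact neg_mem h
  obtain ⟨k, hk⟩ := Submodule.mem_span_singleton.1 h
  obtain ⟨hxC, hx0, hirr⟩ := hx
  have hmR : (0 : ℝ) < m := by exact_mod_cast hpos
  have hr0 : (0 : ℝ) ≤ (k % m : ℤ) := by exact_mod_cast Int.emod_nonneg k hm
  have hrm : ((k % m : ℤ) : ℝ) ≤ m := by exact_mod_cast (Int.emod_lt_of_pos k hpos).le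
  have hz' : m • (z - (k / m) • x) = (k % m) • x := by
    rw [smul_sub, ← hk, smul_smul, ← sub_smul]
    congr 1
    have := Int.emod_add_mul_ediv k m
    linarith
  have hzR : toR (z - (k / m) • x) = (((k % m : ℤ) : ℝ) / m) • toR x := by
    have := congrArg toR hz'
    rw [toR_zsmul, toR_zsmul] at this
    rw [div_eq_inv_mul, mul_smul, ← this, smul_smul, inv_mul_cancel₀ hmR.ne', one_smul]
  by_contra hz
  refine hirr ⟨z - (k / m) • x, x - (z - (k / m) • x), ?_, ?_, ?_, ?_, by abel⟩
  · rw [hzR]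
    exact coneSet_smul (by positivity) hxC
  · rw [toR_sub, hzR]
    convert coneSet_smul (c := 1 - ((k % m : ℤ) : ℝ) / m) ?_ hxC using 1
    · module
    · rw [sub_nonneg, div_le_one hmR]
      exact hrm
  · intro h0
    exact hz (Submodule.mem_span_singleton.2 ⟨k / m, (sub_eq_zero.1 h0).symm⟩)
  · intro h0
    refine hz (Submodule.mem_span_singleton.2 ⟨1 + k / m, ?_⟩)
    rw [add_smul, one_smul]
    nth_rw 1 [sub_eq_zero.1 h0]
    abel

/-- Hilbert basis elements of a projection along `x` lift to Hilbert basis elements. -/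
lemma exists_lift_hilbC {e : ℕ} {x : Fin (e + 1) → ℤ} {B : Finset (Fin (e + 1) → ℤ)}
    (hp : PointedSet (coneSet (B : Set (Fin (e + 1) → ℤ))))
    (hx : toR x ∈ coneSet (B : Set (Fin (e + 1) → ℤ)))
    {P : (Fin (e + 1) → ℤ) →ₗ[ℤ] (Fin e → ℤ)} {S : (Fin e → ℤ) →ₗ[ℤ] (Fin (e + 1) → ℤ)}
    (hPS : ∀ w, P (S w) = w) (hker : ∀ z, P z = 0 → ∃ k : ℤ, z = k • x) (hPx : P x = 0)
    {w : Fin e → ℤ} (hw : w ∈ hilbC (realExt P '' coneSet (B : Set (Fin (e + 1) → ℤ)))) :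
    ∃ h ∈ hilbC (coneSet (B : Set (Fin (e + 1) → ℤ))) \ {x}, P h = w := by
  obtain ⟨⟨c, hc, hcw⟩, hw0, hirr⟩ := hw
  obtain ⟨t, ht⟩ := exists_eq_section_add hPS hker c
  obtain ⟨n, hn⟩ := exists_nat_ge t
  have hz : toR (S w + (n : ℤ) • x) ∈ coneSet (B : Set (Fin (e + 1) → ℤ)) := by
    rw [toR_add, toR_zsmul, ← realExt_toR, ← hcw]
    convert coneSet_add hc (coneSet_smul (sub_nonneg.2 hn) hx) using 1
    nth_rw 2 [ht]
    push_cast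
    module
  have hPz : P (S w + (n : ℤ) • x) = w := by
    rw [map_add, hPS, map_smul, hPx, smul_zero, add_zero]
  have hcl := mem_closure_hilbC B hp hz
  generalize S w + (n : ℤ) • x = z at hz hPz hcl
  suffices toR z ∈ coneSet (B : Set (Fin (e + 1) → ℤ)) ∧ (P z = w →
      ∃ h ∈ hilbC (coneSet (B : Set (Fin (e + 1) → ℤ))) \ {x}, P h = w) from this.2 hPz
  clear hz hPz
  induction hcl using AddSubmonoid.closure_induction with
  | mem z hz =>
    refine ⟨hz.1, fun h => ⟨z, ⟨hz, ?_⟩, h⟩⟩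
    rintro rfl
    exact hw0 (h.symm.trans hPx)
  | zero =>
    refine ⟨by rw [toR_zero]; exact zero_mem_coneSet _, fun h => ?_⟩
    exact absurd (h.symm.trans (map_zero P)) hw0
  | add u v _ _ hu hv =>
    refine ⟨by rw [toR_add]; exact coneSet_add hu.1 hv.1, fun h => ?_⟩
    rw [map_add] at h
    by_cases hu0 : P u = 0
    · exact hv.2 (by rwa [hu0, zero_add] at h)
    by_cases hv0 : P v = 0
    · exact hu.2 (by rwa [hv0, add_zero] at h)
    exact absurd ⟨P u, P v, ⟨_, hu.1, realExt_toR P u⟩, ⟨_, hv.1, realExt_toR P v⟩, hu0, hv0,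
      h.symm⟩ hirr

/-- A lift of a `ℤ`-basis along the projection with kernel `ℤ x`, together with `x`, is a
`ℤ`-basis. -/
lemma cons_lift_basis {e : ℕ} {x : Fin (e + 1) → ℤ} (hx : x ≠ 0)
    {P : (Fin (e + 1) → ℤ) →ₗ[ℤ] (Fin e → ℤ)}
    (hker : ∀ z, P z = 0 → ∃ k : ℤ, z = k • x) (hPx : P x = 0)
    {y : Fin e → (Fin e → ℤ)} {h : Fin e → (Fin (e + 1) → ℤ)} (hh : ∀ k, P (h k) = y k)
    (hli : LinearIndependent ℤ y) (hcl : AddSubgroup.closure (Set.range y) = ⊤) :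
    LinearIndependent ℤ (Fin.cons x h : Fin (e + 1) → (Fin (e + 1) → ℤ)) ∧
      AddSubgroup.closure
        (Set.range (Fin.cons x h : Fin (e + 1) → (Fin (e + 1) → ℤ))) = ⊤ := by
  constructor
  · rw [Fintype.linearIndependent_iff] at hli ⊢
    intro g hg
    rw [Fin.sum_univ_succ] at hg
    simp only [Fin.cons_zero, Fin.cons_succ] at hg
    have hsucc : ∀ i : Fin e, g i.succ = 0 := by
      refine hli (fun i => g i.succ) ?_
      have := congrArg P hg
      simpa only [map_add, map_sum, map_smul, hPx, hh, smul_zero, zero_add, map_zero] using this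
    have h0 : g 0 = 0 := by
      simp only [hsucc, zero_smul, Finset.sum_const_zero, add_zero] at hg
      exact (smul_eq_zero.1 hg).resolve_right hx
    exact fun i => Fin.cases h0 hsucc i
  · rw [Fin.range_cons, eq_top_iff]
    set K := AddSubgroup.closure (insert x (Set.range h))
    have hxK : x ∈ K := AddSubgroup.subset_closure (Set.mem_insert _ _)
    have hmap : ∀ w, w ∈ K.map P.toAddMonoidHom := by
      intro w
      have hw : w ∈ AddSubgroup.closure (Set.range y) := hcl ▸ AddSubgroup.mem_top w
      refine (AddSubgroup.closure_le _).2 ?_ hw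
      rintro _ ⟨k, rfl⟩
      exact ⟨h k, AddSubgroup.subset_closure (Set.mem_insert_of_mem _ ⟨k, rfl⟩), hh k⟩
    intro z _
    obtain ⟨u, hu, huz⟩ := hmap (P z)
    obtain ⟨k, hk⟩ := hker (z - u) (by rw [map_sub]; exact sub_eq_zero.2 huz.symm)
    rw [← sub_add_cancel z u, hk]
    exact add_mem (K.zsmul_mem hxK k) hu

lemma exists_eq_add_smul {d : ℕ} {H : Set (Fin d → ℤ)} (x : Fin d → ℤ) {p : Fin d → ℝ}
    (hp : p ∈ coneSet H) : ∃ c ∈ coneSet (H \ {x}), ∃ t : ℝ, 0 ≤ t ∧ p = c + t • toR x := by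
  refine coneSet_induction (p := fun p => ∃ c ∈ coneSet (H \ {x}), ∃ t : ℝ, 0 ≤ t ∧
    p = c + t • toR x) ?_ ?_ ?_ ?_ hp
  · intro b hb
    by_cases hbx : b = x
    · exact ⟨0, zero_mem_coneSet _, 1, zero_le_one, by simp [hbx]⟩
    · exact ⟨toR b, toR_mem_coneSet ⟨hb, hbx⟩, 0, le_rfl, by simp⟩
  · exact ⟨0, zero_mem_coneSet _, 0, le_rfl, by simp⟩
  · rintro _ _ ⟨c, hc, t, ht, rfl⟩ ⟨c', hc', t', ht', rfl⟩
    exact ⟨c + c', coneSet_add hc hc', t + t', add_nonneg ht ht', by module⟩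
  · rintro a _ ha ⟨c, hc, t, ht, rfl⟩
    exact ⟨a • c, coneSet_smul ha hc, a * t, mul_nonneg ha ht, by module⟩

/-- The projection of a pointed cone along an extreme generator `x` is pointed. -/
lemma pointedSet_image {d e : ℕ} {H : Set (Fin d → ℤ)} {x : Fin d → ℤ}
    (hp : PointedSet (coneSet H)) (hxH : x ∈ H) (hx0 : x ≠ 0)
    (hx : toR x ∉ coneSet (H \ {x})) {L : (Fin d → ℝ) →ₗ[ℝ] (Fin e → ℝ)}
    (hLx : L (toR x) = 0) (hker : ∀ v, L v = 0 → ∃ t : ℝ, v = t • toR x) :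
    PointedSet (L '' coneSet H) := by
  have hsub : coneSet (H \ {x}) ⊆ coneSet H := coneSet_subset fun a ha => toR_mem_coneSet ha.1
  rintro _ ⟨u, hu, rfl⟩ ⟨v, hv, hvu⟩
  obtain ⟨c, hc, s, hs, rfl⟩ := exists_eq_add_smul x hu
  obtain ⟨c', hc', t, ht, rfl⟩ := exists_eq_add_smul x hv
  simp only [map_add, map_smul, hLx, smul_zero, add_zero] at hvu ⊢
  obtain ⟨r, hr⟩ := hker (c + c') (by rw [map_add, hvu, add_neg_cancel])
  have hsum := coneSet_add hc hc'
  rcases lt_trichotomy r 0 with h | h | h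
  · have h1 : -toR x ∈ coneSet H := by
      have := coneSet_smul (c := (-r)⁻¹) (inv_nonneg.2 (by linarith)) (hsub hsum)
      rw [hr, smul_smul] at this
      convert this using 1
      rw [inv_neg, neg_mul, inv_mul_cancel₀ h.ne, neg_one_smul]
    exact absurd (toR_eq_zero.1 (hp _ (toR_mem_coneSet hxH) h1)) hx0
  · rw [h, zero_smul] at hr
    rw [hp c (hsub hc) (by rw [neg_eq_of_add_eq_zero_right hr]; exact hsub hc'), map_zero]
  · refine absurd ?_ hx
    have := coneSet_smul (c := r⁻¹) (inv_nonneg.2 h.le) hsum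
    rwa [hr, smul_smul, inv_mul_cancel₀ h.ne', one_smul] at this

/-- Lemma 4.1 for (UHC): a counterexample to (UHC), minimal first with respect
to dimension and second with respect to the size of its Hilbert basis, is
tight. -/
theorem tight_of_minimal_UHC_counterexample {d : ℕ} (C : Set (Fin d → ℝ))
    (hC : IsRatCone C) (hp : PointedSet C) (hf : FullDim C)
    (hnot : ¬ UHC C)
    (hmindim : ∀ e, e < d → ∀ C' : Set (Fin e → ℝ),
      IsRatCone C' → PointedSet C' → FullDim C' → UHC C')
    (hmincard : ∀ C' : Set (Fin d → ℝ),
      IsRatCone C' → PointedSet C' → FullDim C' →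
      (hilbC C').ncard < (hilbC C).ncard → UHC C') :
    Tight C := by
  rintro x hx hH'
  obtain ⟨B, rfl⟩ := hC
  have hfin := hilbC_finite B
  have hgen := coneSet_hilbC B hp
  set C := coneSet (B : Set (Fin d → ℤ))
  set C' := coneSet (hilbC C \ {x})
  have hsub : C' ⊆ C := coneSet_subset fun a ha => ha.1.1
  have hxC' : toR x ∉ C' := by
    intro h
    have hx' : x ∈ hilbC C' :=
      ⟨h, hx.2.1, fun ⟨u, v, hu, hv, huv⟩ => hx.2.2 ⟨u, v, hsub hu, hsub hv, huv⟩⟩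
    rw [hH'] at hx'
    exact hx'.2 rfl
  have hdec : ∀ p ∈ C, ∃ c ∈ C', ∃ t : ℝ, 0 ≤ t ∧ p = c + t • toR x := fun p hpC =>
    exists_eq_add_smul x (by rwa [hgen])
  have hC'UHC : FullDim C' → UHC C' := by
    intro hfull
    refine hmincard C' ⟨hfin.sdiff.toFinset, by rw [Set.Finite.coe_toFinset]⟩
      (fun y hy hy' => hp y (hsub hy) (hsub hy')) hfull ?_
    rw [hH']
    exact Set.ncard_sdiff_singleton_lt_of_mem hx hfin
  obtain _ | e := d
  · exact hx.2.1 (Subsingleton.elim _ _)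
  obtain ⟨P, S, hPS, hker, hPx⟩ := exists_splitting hx.2.1 (saturated_of_mem_hilbC hx)
  have hsec := exists_eq_section_add hPS hker
  have hPRx : realExt P (toR x) = 0 := by rw [realExt_toR, hPx, toR_zero]
  have hkerR : ∀ v, realExt P v = 0 → ∃ t : ℝ, v = t • toR x := fun v hv => by
    obtain ⟨t, ht⟩ := hsec v
    exact ⟨t, by rwa [hv, map_zero, zero_add] at ht⟩
  have hDUHC : UHC (realExt P '' C) := by
    refine hmindim e e.lt_succ_self _ ?_ ?_ ?_
    · classical
      exact ⟨B.image P, by rw [Finset.coe_image, ← coneSet_image]⟩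
    · have := pointedSet_image (by rwa [hgen]) hx hx.2.1 hxC' hPRx hkerR
      rwa [hgen] at this
    · have hsurj : (realExt P).range = ⊤ := by
        rw [eq_top_iff, ← span_range_toR, Submodule.span_le]
        rintro _ ⟨w, rfl⟩
        exact ⟨toR (S w), by rw [realExt_toR, hPS]⟩
      rw [FullDim, Submodule.span_image, hf, Submodule.map_top, hsurj]
  refine hnot fun p hpC => ?_
  obtain ⟨y, hyD, hyli, hycl, a, ha, hay⟩ := hDUHC (realExt P p) ⟨p, hpC, rfl⟩
  choose h hhmem hhP using fun k => exists_lift_hilbC hp hx.1 hPS hker hPx (hyD k)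
  set q : Fin (e + 1) → ℝ := ∑ k, a k • toR (h k) with hq
  have hqC' : q ∈ C' := ⟨e, h, a, hhmem, ha, rfl⟩
  obtain ⟨b, hb⟩ := hkerR (p - q) (by simp [hay, hq, realExt_toR, hhP])
  rw [sub_eq_iff_eq_add'] at hb
  by_cases hb0 : 0 ≤ b
  · obtain ⟨hli, hcl⟩ := cons_lift_basis hx.2.1 hker hPx hhP hyli hycl
    refine ⟨Fin.cons x h, Fin.cases hx fun k => (hhmem k).1, hli, hcl, Fin.cons b a,
      Fin.cases hb0 ha, ?_⟩
    rw [Fin.sum_univ_succ]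
    simp only [Fin.cons_zero, Fin.cons_succ]
    exact hb.trans (add_comm _ _)
  push Not at hb0
  obtain ⟨c, hc, t, ht, hpt⟩ := hdec p hpC
  have hline : (t - b) • toR x = q - c := by
    rw [sub_smul, sub_eq_sub_iff_add_eq_add]
    exact (add_comm _ _).trans (hpt.symm.trans hb)
  have htb : 0 < t - b := by linarith
  by_cases hfull : FullDim C'
  · have hpC' : p ∈ C' := by
      have hpeq : p = ((-b) / (t - b)) • c + (t / (t - b)) • q := by
        have hx' : toR x = (t - b)⁻¹ • (q - c) := by
          rw [← hline, smul_smul, inv_mul_cancel₀ htb.ne', one_smul]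
        have h1 : (-b) / (t - b) = 1 - t * (t - b)⁻¹ := by field_simp; ring
        rw [h1, hpt, hx', div_eq_mul_inv]
        module
      rw [hpeq]
      exact coneSet_add (coneSet_smul (div_nonneg (by linarith) htb.le) hc)
        (coneSet_smul (div_nonneg ht htb.le) hqC')
    obtain ⟨y', hy', hrest⟩ := hC'UHC hfull p hpC'
    exact ⟨y', fun k => (hH' ▸ hy' k : y' k ∈ hilbC C \ {x}).1, hrest⟩
  · refine absurd ?_ hfull
    have hxspan : toR x ∈ Submodule.span ℝ C' := by
      rw [← one_smul ℝ (toR x), ← inv_mul_cancel₀ htb.ne', mul_smul, hline]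
      exact Submodule.smul_mem _ _
        (sub_mem (Submodule.subset_span hqC') (Submodule.subset_span hc))
    rw [FullDim, eq_top_iff, ← hf, Submodule.span_le]
    intro v hv
    obtain ⟨c', hc', s, -, rfl⟩ := hdec v hv
    exact add_mem (Submodule.subset_span hc') (Submodule.smul_mem _ _ hxspan)
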